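/- Let c̃ > 0 be such that H̄(c̃) := lim_{ρ→ρ₁(c̃)⁻} H(ρ, c̃) = 0. Then there exists δ > 0 such that for every c > 0 with |c − c̃| < δ one has either N(c) = N(c̃) or N(c) = N(c̃) + 1. -/

import Mathlib

open Real Filter Set Topology Asymptotics MeasureTheory

noncomputable section

/-- The CSS (continuously self-similar) system for `(H, A, Z)` with derivative
function `H'`, on the interval `(0, ρ₁)`, together with the constraint, the
positivity/range conditions, and the initial conditions at `ρ = 0`:
`H(0) = -π/2`, `H'(0) = c`, `A(0) = 1`, `Z(0) = 0`, `Z'(0) = 1`.  This is the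
notion of a `c`-orbit. -/
structure IsCOrbit (α c : ℝ) (H H' A Z : ℝ → ℝ) (ρ₁ : ℝ) : Prop where
  rho1_pos : 0 < ρ₁
  hH : ∀ ρ ∈ Set.Ioo 0 ρ₁, HasDerivAt H (H' ρ) ρ
  hH' : ∀ ρ ∈ Set.Ioo 0 ρ₁, HasDerivAt H'
      (α * (1 + Z ρ ^ 2) * ρ * H' ρ ^ 3 - (2 / ρ) * H' ρ
        - Real.sin (2 * H ρ) / (A ρ * ρ ^ 2 * (1 - Z ρ ^ 2))) ρ
  hA : ∀ ρ ∈ Set.Ioo 0 ρ₁, HasDerivAt A (-2 * α * ρ * A ρ * H' ρ ^ 2) ρ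
  hZ : ∀ ρ ∈ Set.Ioo 0 ρ₁, HasDerivAt Z
      (Z ρ * (1 + α * (1 - Z ρ ^ 2) * ρ ^ 2 * H' ρ ^ 2) / ρ) ρ
  constraint : ∀ ρ ∈ Set.Ioo 0 ρ₁,
      1 - 2 * α - A ρ + 2 * α * Real.sin (H ρ) ^ 2
        + α * A ρ * ρ ^ 2 * H' ρ ^ 2 * (1 - Z ρ ^ 2) = 0
  hApos : ∀ ρ ∈ Set.Ioo 0 ρ₁, 0 < A ρ
  hZ01 : ∀ ρ ∈ Set.Ioo 0 ρ₁, 0 ≤ Z ρ ∧ Z ρ < 1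
  H0 : H 0 = -(π / 2)
  A0 : A 0 = 1
  Z0 : Z 0 = 0
  Hcont : Tendsto H (𝓝[>] 0) (𝓝 (-(π / 2)))
  H'init : Tendsto H' (𝓝[>] 0) (𝓝 c)
  Acont : Tendsto A (𝓝[>] 0) (𝓝 1)
  Zcont : Tendsto Z (𝓝[>] 0) (𝓝 0)
  Z'init : Tendsto (fun ρ => Z ρ / ρ) (𝓝[>] 0) (𝓝 1)

/-- The mean value theorem for a function differentiable on a closed interval. -/
lemma exists_sub_eq_deriv_mul {f f' : ℝ → ℝ} {a b : ℝ} (hab : a < b)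
    (hf : ∀ x ∈ Icc a b, HasDerivAt f (f' x) x) :
    ∃ x ∈ Ioo a b, f b - f a = f' x * (b - a) := by
  obtain ⟨x, hx, h⟩ := exists_hasDerivAt_eq_slope f f' hab
    (fun x hx => (hf x hx).continuousAt.continuousWithinAt)
    (fun x hx => hf x (Ioo_subset_Icc_self hx))
  refine ⟨x, hx, ?_⟩
  rw [h, div_mul_cancel₀ _ (sub_pos.2 hab).ne']

namespace IsCOrbit

variable {α c : ℝ} {H H' A Z : ℝ → ℝ} {ρ₁ : ℝ}

lemma one_sub_sq_pos (h : IsCOrbit α c H H' A Z ρ₁) {ρ : ℝ} (hρ : ρ ∈ Ioo 0 ρ₁) :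
    0 < 1 - Z ρ ^ 2 := by
  obtain ⟨h0, h1⟩ := h.hZ01 ρ hρ
  nlinarith

lemma le_A (h : IsCOrbit α c H H' A Z ρ₁) (hα : 0 < α) {ρ : ℝ} (hρ : ρ ∈ Ioo 0 ρ₁) :
    1 - 2 * α ≤ A ρ := by
  have h1 := h.constraint ρ hρ
  have h2 := h.one_sub_sq_pos hρ
  have h3 := h.hApos ρ hρ
  have h4 : 0 ≤ α * A ρ * ρ ^ 2 * H' ρ ^ 2 * (1 - Z ρ ^ 2) := by positivity
  have h5 : 0 ≤ 2 * α * sin (H ρ) ^ 2 := by positivity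
  linarith

lemma Z_div_monotoneOn (h : IsCOrbit α c H H' A Z ρ₁) (hα : 0 < α) :
    MonotoneOn (fun ρ => Z ρ / ρ) (Ioo 0 ρ₁) := by
  have hd : ∀ ρ ∈ Ioo 0 ρ₁, HasDerivAt (fun ρ => Z ρ / ρ)
      (Z ρ * (α * (1 - Z ρ ^ 2) * H' ρ ^ 2)) ρ := by
    intro ρ hρ
    have hρ0 : ρ ≠ 0 := hρ.1.ne'
    refine ((h.hZ ρ hρ).fun_div (hasDerivAt_id' ρ) hρ0).congr_deriv ?_
    field_simp
    ring
  refine monotoneOn_of_hasDerivWithinAt_nonneg (convex_Ioo 0 ρ₁)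
    (fun ρ hρ => (hd ρ hρ).continuousAt.continuousWithinAt)
    (fun ρ hρ => (hd ρ (interior_subset hρ)).hasDerivWithinAt) ?_
  intro ρ hρ
  have hρ := interior_subset hρ
  have := h.one_sub_sq_pos hρ
  have := (h.hZ01 ρ hρ).1
  positivity

lemma one_le_Z_div (h : IsCOrbit α c H H' A Z ρ₁) (hα : 0 < α) {ρ : ℝ} (hρ : ρ ∈ Ioo 0 ρ₁) :
    1 ≤ Z ρ / ρ := by
  refine le_of_tendsto h.Z'init ?_
  filter_upwards [Ioo_mem_nhdsGT hρ.1] with x hx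
  exact h.Z_div_monotoneOn hα ⟨hx.1, hx.2.trans hρ.2⟩ hρ hx.2.le

lemma Z_pos (h : IsCOrbit α c H H' A Z ρ₁) (hα : 0 < α) {ρ : ℝ} (hρ : ρ ∈ Ioo 0 ρ₁) :
    0 < Z ρ := by
  have := h.one_le_Z_div hα hρ
  rw [le_div_iff₀ hρ.1] at this
  linarith [hρ.1]

lemma Z_monotoneOn (h : IsCOrbit α c H H' A Z ρ₁) (hα : 0 < α) : MonotoneOn Z (Ioo 0 ρ₁) := by
  intro x hx y hy hxy
  have h1 := h.Z_div_monotoneOn hα hx hy hxy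
  have h2 := h.Z_pos hα hy
  simp only at h1
  rw [div_le_div_iff₀ hx.1 hy.1] at h1
  have := hx.1
  have := hy.1
  nlinarith

/-- The product `Z A ρ H'` has a derivative proportional to `sin (2 H)`. -/
lemma hasDerivAt_momentum (h : IsCOrbit α c H H' A Z ρ₁) {ρ : ℝ} (hρ : ρ ∈ Ioo 0 ρ₁) :
    HasDerivAt (fun ρ => Z ρ * A ρ * ρ * H' ρ)
      (-(Z ρ * sin (2 * H ρ) / (ρ * (1 - Z ρ ^ 2)))) ρ := by
  have hρ0 : ρ ≠ 0 := hρ.1.ne'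
  have hA := (h.hApos ρ hρ).ne'
  have hu := (h.one_sub_sq_pos hρ).ne'
  refine ((((h.hZ ρ hρ).fun_mul (h.hA ρ hρ)).fun_mul (hasDerivAt_id' ρ)).fun_mul
    (h.hH' ρ hρ)).congr_deriv ?_
  field_simp
  ring

/-- The zeros of `H` are simple. -/
lemma deriv_ne_zero (h : IsCOrbit α c H H' A Z ρ₁) (hα : 0 < α) (hα' : α < 1 / 2)
    {b : ℝ} (hb : b ∈ Ioo 0 ρ₁) (hHb : H b = 0) : H' b ≠ 0 := by
  intro hH'b
  have key : ∀ a ∈ Ioo 0 b, H a = 0 := by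
    intro a ha
    have hsub : ∀ x ∈ Icc a b, x ∈ Ioo 0 ρ₁ := fun x hx =>
      ⟨ha.1.trans_le hx.1, hx.2.trans_lt hb.2⟩
    have haρ : a ∈ Ioo 0 ρ₁ := hsub a ⟨le_rfl, ha.2.le⟩
    have hbr : ∀ x ∈ Icc 0 (b - a), b - x ∈ Icc a b := fun x hx =>
      ⟨by linarith [hx.2], by linarith [hx.1]⟩
    set Q : ℝ → ℝ := fun ρ => Z ρ * A ρ * ρ * H' ρ with hQ
    have hm : 0 < 1 - 2 * α := by linarith
    have hZa := h.Z_pos hα haρ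
    have hub := h.one_sub_sq_pos hb
    set C : ℝ := max (1 / (Z a * (1 - 2 * α) * a)) (2 / (a * (1 - Z b ^ 2))) with hC
    have hd : ∀ x ∈ Icc 0 (b - a), HasDerivAt (fun x => (H (b - x), Q (b - x)))
        (-H' (b - x), Z (b - x) * sin (2 * H (b - x)) / ((b - x) * (1 - Z (b - x) ^ 2))) x := by
      intro x hx
      have hx' := hsub _ (hbr x hx)
      refine HasDerivAt.prodMk ?_ ?_
      · exact (h.hH _ hx').comp_const_sub b x
      · simpa using (h.hasDerivAt_momentum hx').comp_const_sub b x
    have hz := eq_zero_of_abs_deriv_le_mul_abs_self_of_eq_zero_right (K := C)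
      (fun x hx => (hd x hx).continuousAt.continuousWithinAt)
      (fun x hx => (hd x (Ico_subset_Icc_self hx)).hasDerivWithinAt) (by simp [hHb, hQ, hH'b]) ?_
    · have := hz (b - a) ⟨by linarith [ha.2], le_rfl⟩
      simpa using congrArg Prod.fst this
    · intro x hx
      have hx1 := hbr x (Ico_subset_Icc_self hx)
      have hx' := hsub _ hx1
      set y := b - x with hy
      have hya : a ≤ y := hx1.1
      have hy0 : 0 < y := hx'.1
      have hZ1 : Z a ≤ Z y := h.Z_monotoneOn hα haρ hx' hx1.1
      have hZ2 : Z y ≤ Z b := h.Z_monotoneOn hα hx' hb hx1.2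
      have hAy := h.le_A hα hx'
      have hu := h.one_sub_sq_pos hx'
      have hZy := h.hZ01 y hx'
      have ha0 := ha.1
      have hC0 : 0 ≤ C := le_max_of_le_left (by positivity)
      rw [Prod.norm_def]
      refine max_le ?_ ?_
      · refine le_trans ?_ (mul_le_mul_of_nonneg_left (le_max_right _ _) hC0)
        refine le_trans ?_ (mul_le_mul_of_nonneg_right (le_max_left _ _) (norm_nonneg _))
        have hle : Z a * (1 - 2 * α) * a ≤ Z y * A y * y := by
          have := h.hApos y hx'
          have := hZy.1
          gcongr
        have hpos : 0 < Z a * (1 - 2 * α) * a := by positivity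
        simp only [hQ, Real.norm_eq_abs, abs_neg, abs_mul _ (H' y)]
        rw [abs_of_pos (hpos.trans_le hle), one_div_mul_eq_div, le_div_iff₀ hpos, mul_comm]
        gcongr
      · refine le_trans ?_ (mul_le_mul_of_nonneg_left (le_max_left _ _) hC0)
        refine le_trans ?_ (mul_le_mul_of_nonneg_right (le_max_right _ _) (norm_nonneg _))
        have hle : a * (1 - Z b ^ 2) ≤ y * (1 - Z y ^ 2) := by
          have : Z y ^ 2 ≤ Z b ^ 2 := by gcongr; exact hZy.1
          gcongr
        have hpos : 0 < a * (1 - Z b ^ 2) := by positivity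
        have hs : |sin (2 * H y)| ≤ 2 * |H y| := by
          have := abs_sin_le_abs (x := 2 * H y)
          rwa [abs_mul, abs_two] at this
        simp only [Real.norm_eq_abs, abs_div, abs_mul]
        rw [abs_of_nonneg hZy.1, abs_of_pos hy0, abs_of_pos hu, div_mul_eq_mul_div]
        refine div_le_div₀ (by positivity) ?_ hpos hle
        calc Z y * |sin (2 * H y)| ≤ 1 * (2 * |H y|) := by
              gcongr; exact hZy.2.le
          _ = _ := one_mul _
  have h1 : Tendsto H (𝓝[>] 0) (𝓝 0) := by
    refine tendsto_const_nhds.congr' ?_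
    filter_upwards [Ioo_mem_nhdsGT hb.1] with x hx
    exact (key x hx).symm
  have := tendsto_nhds_unique h1 h.Hcont
  linarith [pi_pos]

/-- Close enough to the singular point `Z = 1` the function `H` has at most one zero. -/
lemma not_two_zeros (h : IsCOrbit α c H H' A Z ρ₁) (hα : 0 < α) (hα' : α < 1 / 2)
    {a b : ℝ} (ha : 0 < a) (hab : a < b) (hb : b < ρ₁)
    (hZa : 1 - (1 - 2 * α) / 64 ≤ Z a) (hHa : H a = 0) (hHb : H b = 0) : False := by
  have hsub : ∀ x ∈ Icc a b, x ∈ Ioo 0 ρ₁ := fun x hx =>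
    ⟨ha.trans_le hx.1, hx.2.trans_lt hb⟩
  have haρ : a ∈ Ioo 0 ρ₁ := hsub a ⟨le_rfl, hab.le⟩
  have hbρ : b ∈ Ioo 0 ρ₁ := hsub b ⟨hab.le, le_rfl⟩
  have hb0 : 0 < b := hbρ.1
  have hm : 0 < 1 - 2 * α := by linarith
  have hz : 1 / 2 ≤ Z a := by linarith
  have hz0 : 0 < Z a := by linarith
  obtain ⟨x₀, hx₀, hmax⟩ := isCompact_Icc.exists_isMaxOn (nonempty_Icc.2 hab.le)
    (f := fun x => |H' x|)
    (fun x hx => (h.hH' x (hsub x hx)).continuousAt.continuousWithinAt.abs)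
  set M := |H' x₀| with hM
  have hM0 : 0 ≤ M := abs_nonneg _
  have hbd : ∀ x ∈ Icc a b, |H' x| ≤ M := fun x hx => hmax hx
  have hHle : ∀ x ∈ Ico a b, |H x| ≤ M * (b - x) := by
    intro x hx
    obtain ⟨y, hy, e⟩ := exists_sub_eq_deriv_mul hx.2
      (fun t ht => h.hH t (hsub t ⟨hx.1.trans ht.1, ht.2⟩))
    rw [hHb, zero_sub] at e
    rw [← abs_neg, e, abs_mul, abs_of_pos (sub_pos.2 hx.2)]
    exact mul_le_mul_of_nonneg_right (hbd y ⟨hx.1.trans hy.1.le, hy.2.le⟩)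
      (sub_pos.2 hx.2).le
  have hule : ∀ x ∈ Ico a b, 2 * Z a ^ 2 * (b - x) ≤ (1 - Z x ^ 2) * b := by
    intro x hx
    have hd : ∀ t ∈ Icc x b, HasDerivAt (fun ρ => Z ρ ^ 2) (2 * Z t *
        (Z t * (1 + α * (1 - Z t ^ 2) * t ^ 2 * H' t ^ 2) / t)) t := by
      intro t ht
      simpa using (h.hZ t (hsub t ⟨hx.1.trans ht.1, ht.2⟩)).fun_pow 2
    obtain ⟨y, hy, e⟩ := exists_sub_eq_deriv_mul hx.2 hd
    have hyI : y ∈ Icc a b := ⟨hx.1.trans hy.1.le, hy.2.le⟩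
    have hyρ := hsub y hyI
    have hZy := h.Z_monotoneOn hα haρ hyρ hyI.1
    have hu := h.one_sub_sq_pos hyρ
    have hub := h.one_sub_sq_pos hbρ
    have hbx := sub_pos.2 hx.2
    have hy0 := hyρ.1
    have h1 : 2 * Z a ^ 2 / b ≤ 2 * Z y *
        (Z y * (1 + α * (1 - Z y ^ 2) * y ^ 2 * H' y ^ 2) / y) := by
      have h2 : 2 * Z a ^ 2 / b ≤ 2 * Z y ^ 2 / y := by gcongr; exact hyI.2
      refine h2.trans ?_
      have h3 : 2 * Z y * (Z y * (1 + α * (1 - Z y ^ 2) * y ^ 2 * H' y ^ 2) / y)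
          = 2 * Z y ^ 2 / y + 2 * Z y ^ 2 / y * (α * (1 - Z y ^ 2) * y ^ 2 * H' y ^ 2) := by
        ring
      rw [h3]
      have : 0 ≤ 2 * Z y ^ 2 / y * (α * (1 - Z y ^ 2) * y ^ 2 * H' y ^ 2) := by positivity
      linarith
    have h4 := mul_le_mul_of_nonneg_right h1 hbx.le
    rw [← e, div_mul_eq_mul_div, div_le_iff₀ hb0] at h4
    nlinarith
  obtain ⟨m, hmI, hHm⟩ := exists_hasDerivAt_eq_zero hab
    (fun x hx => (h.hH x (hsub x hx)).continuousAt.continuousWithinAt) (hHa.trans hHb.symm)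
    (fun x hx => h.hH x (hsub x (Ioo_subset_Icc_self hx)))
  have hba : b ≤ a / Z a := by
    have h1 : Z a / a ≤ Z b / b := h.Z_div_monotoneOn hα haρ hbρ hab.le
    rw [div_le_div_iff₀ ha hb0] at h1
    rw [le_div_iff₀ hz0]
    nlinarith [(h.hZ01 b hbρ).2]
  set K := M * b / (a * Z a ^ 2) with hK
  have hQ : ∀ x ∈ Icc a b, |Z x * A x * x * H' x| ≤ K * (b - a) := by
    intro x hx
    have hder : ∀ y ∈ Icc a b, ‖-(Z y * sin (2 * H y) / (y * (1 - Z y ^ 2)))‖ ≤ K := by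
      intro y hy
      rcases hy.2.eq_or_lt with rfl | hyb
      · simp only [hHb, mul_zero, sin_zero, zero_div, neg_zero, norm_zero]
        positivity
      have hyρ := hsub y hy
      have hZy := h.hZ01 y hyρ
      have hu := h.one_sub_sq_pos hyρ
      have hy0 := hyρ.1
      have h1 := hHle y ⟨hy.1, hyb⟩
      have h2 := hule y ⟨hy.1, hyb⟩
      have hs : |sin (2 * H y)| ≤ 2 * |H y| := by
        have := abs_sin_le_abs (x := 2 * H y)
        rwa [abs_mul, abs_two] at this
      rw [norm_neg, Real.norm_eq_abs, abs_div, abs_mul, abs_of_nonneg hZy.1,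
        abs_of_pos (mul_pos hy0 hu), div_le_iff₀ (mul_pos hy0 hu), hK, div_mul_eq_mul_div,
        le_div_iff₀ (by positivity)]
      calc Z y * |sin (2 * H y)| * (a * Z a ^ 2) ≤ 1 * (2 * (M * (b - y))) * (y * Z a ^ 2) := by
            gcongr
            · exact hZy.2.le
            · exact hs.trans (by linarith)
            · exact hy.1
        _ = M * y * (2 * Z a ^ 2 * (b - y)) := by ring
        _ ≤ M * y * ((1 - Z y ^ 2) * b) := by gcongr
        _ = _ := by ring
    have h1 := (convex_Icc a b).norm_image_sub_le_of_norm_hasDerivWithin_le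
      (fun y hy => (h.hasDerivAt_momentum (hsub y hy)).hasDerivWithinAt) hder
      (Ioo_subset_Icc_self hmI) hx
    simp only [hHm, mul_zero, sub_zero, Real.norm_eq_abs] at h1
    refine h1.trans ?_
    have hK0 : 0 ≤ K := by positivity
    gcongr
    rw [abs_le]
    constructor <;> linarith [hx.1, hx.2, hmI.1, hmI.2]
  have hM' : M = 0 := by
    have h1 := hQ x₀ hx₀
    have hxρ := hsub x₀ hx₀
    have hle : Z a * (1 - 2 * α) * a ≤ Z x₀ * A x₀ * x₀ := by
      have := h.hApos x₀ hxρ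
      have := (h.hZ01 x₀ hxρ).1
      gcongr
      · exact h.Z_monotoneOn hα haρ hxρ hx₀.1
      · exact h.le_A hα hxρ
      · exact hx₀.1
    have hpos : 0 < Z a * (1 - 2 * α) * a := by positivity
    rw [abs_mul, abs_of_pos (hpos.trans_le hle), ← hM] at h1
    have h2 : Z a * (1 - 2 * α) * a * M ≤ M * b / (a * Z a ^ 2) * (b - a) :=
      (mul_le_mul_of_nonneg_right hle hM0).trans h1
    have h3 : M * b / (a * Z a ^ 2) * (b - a) ≤
        M * (a / Z a) / (a * Z a ^ 2) * (a / Z a - a) := by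
      have := hab.le
      gcongr
    have h4 : M * (a / Z a) / (a * Z a ^ 2) * (a / Z a - a) = M * a * (1 - Z a) / Z a ^ 4 := by
      field_simp
    have h5 : Z a * (1 - 2 * α) * a * M ≤ M * a * (1 - Z a) / Z a ^ 4 := by linarith
    rw [le_div_iff₀ (by positivity)] at h5
    have h6 : (1 / 2 : ℝ) ^ 5 ≤ Z a ^ 5 := by gcongr
    have h7 : 0 < Z a ^ 5 * (1 - 2 * α) - (1 - Z a) := by nlinarith
    have h8 : M * a * (Z a ^ 5 * (1 - 2 * α) - (1 - Z a)) ≤ 0 := by nlinarith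
    by_contra hne
    have : 0 < M := lt_of_le_of_ne hM0 (Ne.symm hne)
    have : 0 < M * a * (Z a ^ 5 * (1 - 2 * α) - (1 - Z a)) := by positivity
    linarith
  have h1 := hbd a ⟨le_rfl, hab.le⟩
  rw [hM'] at h1
  exact h.deriv_ne_zero hα hα' haρ hHa (abs_nonpos_iff.1 h1)

end IsCOrbit

lemma exists_zero_near_of_le_deriv {f f' g : ℝ → ℝ} {a b μ δ ε t : ℝ}
    (hf : ∀ x ∈ Icc a b, HasDerivAt f (f' x) x) (hg : ContinuousOn g (Icc a b))
    (hδ : 0 < δ) (hμ : 0 < μ) (hε : ε < μ * δ)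
    (hfa : ε < |f a|) (hfb : ε < |f b|) (hfg : ∀ x ∈ Icc a b, |f x - g x| ≤ ε)
    (ht : t ∈ Icc a b) (hft : f t = 0) (hd : ∀ y ∈ Icc a b, |y - t| ≤ δ → μ ≤ f' y) :
    ∃ s ∈ Icc a b, |s - t| ≤ δ ∧ g s = 0 := by
  have hl : ∃ l ∈ Icc a t, t - l ≤ δ ∧ f l < -ε := by
    have key : ∀ l ∈ Icc a t, t - l ≤ δ → f l ≤ -(μ * (t - l)) := by
      intro l hl hlδ
      rcases hl.2.eq_or_lt with rfl | hlt
      · simp [hft]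
      obtain ⟨x, hx, e⟩ := exists_sub_eq_deriv_mul hlt
        (fun x hx => hf x ⟨hl.1.trans hx.1, hx.2.trans ht.2⟩)
      have := hd x ⟨hl.1.trans hx.1.le, hx.2.le.trans ht.2⟩
        (by rw [abs_le]; constructor <;> linarith [hx.1, hx.2])
      nlinarith
    rcases le_total (t - a) δ with h | h
    · refine ⟨a, ⟨le_rfl, ht.1⟩, h, ?_⟩
      have h1 := key a ⟨le_rfl, ht.1⟩ h
      have h2 : 0 ≤ μ * (t - a) := mul_nonneg hμ.le (sub_nonneg.2 ht.1)
      rw [abs_of_nonpos (by linarith)] at hfa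
      linarith
    · refine ⟨t - δ, ⟨by linarith, by linarith⟩, by linarith, ?_⟩
      have h1 := key (t - δ) ⟨by linarith, by linarith⟩ (by linarith)
      rw [sub_sub_cancel] at h1
      linarith
  have hr : ∃ r ∈ Icc t b, r - t ≤ δ ∧ ε < f r := by
    have key : ∀ r ∈ Icc t b, r - t ≤ δ → μ * (r - t) ≤ f r := by
      intro r hr hrδ
      rcases hr.1.eq_or_lt with rfl | hlt
      · simp [hft]
      obtain ⟨x, hx, e⟩ := exists_sub_eq_deriv_mul hlt
        (fun x hx => hf x ⟨ht.1.trans hx.1, hx.2.trans hr.2⟩)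
      have := hd x ⟨ht.1.trans hx.1.le, hx.2.le.trans hr.2⟩
        (by rw [abs_le]; constructor <;> linarith [hx.1, hx.2])
      nlinarith
    rcases le_total (b - t) δ with h | h
    · refine ⟨b, ⟨ht.2, le_rfl⟩, h, ?_⟩
      have h1 := key b ⟨ht.2, le_rfl⟩ h
      have h2 : 0 ≤ μ * (b - t) := mul_nonneg hμ.le (sub_nonneg.2 ht.2)
      rwa [abs_of_nonneg (by linarith)] at hfb
    · refine ⟨t + δ, ⟨by linarith, by linarith⟩, by linarith, ?_⟩
      have h1 := key (t + δ) ⟨by linarith, by linarith⟩ (by linarith)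
      rw [add_sub_cancel_left] at h1
      linarith
  obtain ⟨l, hl, hlδ, hfl⟩ := hl
  obtain ⟨r, hr, hrδ, hfr⟩ := hr
  have hsub : Icc l r ⊆ Icc a b := Icc_subset_Icc hl.1 hr.2
  have hlr : l ≤ r := hl.2.trans hr.1
  have h1 := abs_le.1 (hfg l (hsub ⟨le_rfl, hlr⟩))
  have h2 := abs_le.1 (hfg r (hsub ⟨hlr, le_rfl⟩))
  obtain ⟨s, hs, hgs⟩ := intermediate_value_Icc hlr (hg.mono hsub)
    (show (0 : ℝ) ∈ Icc (g l) (g r) from ⟨by linarith, by linarith⟩)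
  exact ⟨s, hsub hs, by rw [abs_le]; constructor <;> linarith [hs.1, hs.2], hgs⟩

lemma encard_zeros_le {f f' g : ℝ → ℝ} {a b μ δ ε : ℝ}
    (hf : ∀ x ∈ Icc a b, HasDerivAt f (f' x) x) (hg : ContinuousOn g (Icc a b))
    (hδ : 0 < δ) (hμ : 0 < μ) (hε : ε < μ * δ)
    (hfa : ε < |f a|) (hfb : ε < |f b|) (hfg : ∀ x ∈ Icc a b, |f x - g x| ≤ ε)
    (hd : ∀ t ∈ Icc a b, (f t = 0 ∨ g t = 0) →
      (∀ y ∈ Icc a b, |y - t| ≤ δ → μ ≤ f' y) ∨ (∀ y ∈ Icc a b, |y - t| ≤ δ → f' y ≤ -μ)) :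
    {x ∈ Icc a b | f x = 0}.encard ≤ {x ∈ Icc a b | g x = 0}.encard := by
  have hex : ∀ t, t ∈ Icc a b ∧ f t = 0 → ∃ s ∈ Icc a b, |s - t| ≤ δ ∧ g s = 0 := by
    rintro t ⟨ht, hft⟩
    rcases hd t ht (Or.inl hft) with h | h
    · exact exists_zero_near_of_le_deriv hf hg hδ hμ hε hfa hfb hfg ht hft h
    · obtain ⟨s, hs, hst, hgs⟩ := exists_zero_near_of_le_deriv (f := fun x => -f x)
        (f' := fun x => -f' x) (g := fun x => -g x)
        (fun x hx => (hf x hx).fun_neg) hg.fun_neg hδ hμ hε (by rwa [abs_neg])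
        (by rwa [abs_neg]) (fun x hx => by
          rw [neg_sub_neg, abs_sub_comm]; exact hfg x hx) ht (by simp [hft])
        (fun y hy hyt => by linarith [h y hy hyt])
      exact ⟨s, hs, hst, neg_eq_zero.1 hgs⟩
  choose! φ hφI hφδ hφ0 using hex
  refine Set.encard_le_encard_of_injOn (f := φ) (fun t ht => ⟨hφI t ht, hφ0 t ht⟩) ?_
  have hlt : ∀ t₁ t₂, t₁ ∈ Icc a b ∧ f t₁ = 0 → t₂ ∈ Icc a b ∧ f t₂ = 0 → φ t₁ = φ t₂ →
      ¬ t₁ < t₂ := by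
    intro t₁ t₂ h₁ h₂ he hlt
    obtain ⟨x, hx, e⟩ := exists_sub_eq_deriv_mul hlt
      (fun x hx => hf x ⟨h₁.1.1.trans hx.1, hx.2.trans h₂.1.2⟩)
    rw [h₁.2, h₂.2, sub_self, eq_comm, mul_eq_zero] at e
    have hx0 : f' x = 0 := e.resolve_right (sub_pos.2 hlt).ne'
    have hxI : x ∈ Icc a b := ⟨h₁.1.1.trans hx.1.le, hx.2.le.trans h₂.1.2⟩
    have d1 := abs_le.1 (hφδ t₁ h₁)
    have d2 := abs_le.1 (hφδ t₂ h₂)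
    have hxd : |x - φ t₁| ≤ δ := by
      rw [← he] at d2
      rw [abs_le]; constructor <;> linarith [hx.1, hx.2]
    rcases hd (φ t₁) (hφI t₁ h₁) (Or.inr (hφ0 t₁ h₁)) with h | h
    · linarith [h x hxI hxd]
    · linarith [h x hxI hxd]
  intro t₁ h₁ t₂ h₂ he
  exact le_antisymm (not_lt.1 (hlt t₂ t₁ h₂ h₁ he.symm)) (not_lt.1 (hlt t₁ t₂ h₁ h₂ he))

/-- The number of zeros of a function with simple zeros is stable under `C¹`-small
perturbations. -/
lemma exists_encard_zeros_eq {f f' : ℝ → ℝ} {a b : ℝ} (hab : a ≤ b)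
    (hf : ∀ x ∈ Icc a b, HasDerivAt f (f' x) x) (hf' : ContinuousOn f' (Icc a b))
    (hfa : f a ≠ 0) (hfb : f b ≠ 0) (hs : ∀ x ∈ Icc a b, f x = 0 → f' x ≠ 0) :
    ∃ ε > 0, ∀ g g' : ℝ → ℝ, (∀ x ∈ Icc a b, HasDerivAt g (g' x) x) →
      (∀ x ∈ Icc a b, |f x - g x| ≤ ε) → (∀ x ∈ Icc a b, |f' x - g' x| ≤ ε) →
      {x ∈ Icc a b | g x = 0}.encard = {x ∈ Icc a b | f x = 0}.encard := by
  have hfc : ContinuousOn f (Icc a b) := fun x hx => (hf x hx).continuousAt.continuousWithinAt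
  obtain ⟨x₀, hx₀, hmin⟩ := isCompact_Icc.exists_isMinOn (nonempty_Icc.2 hab)
    (hfc.abs.add hf'.abs)
  obtain ⟨μ, hμ⟩ : ∃ μ, μ = (|f x₀| + |f' x₀|) / 4 := ⟨_, rfl⟩
  have hμ0 : 0 < μ := by
    have h1 := abs_nonneg (f x₀)
    have h2 := abs_nonneg (f' x₀)
    by_cases h : f x₀ = 0
    · have := abs_pos.2 (hs x₀ hx₀ h)
      linarith
    · have := abs_pos.2 h
      linarith
  have hμle : ∀ x ∈ Icc a b, 4 * μ ≤ |f x| + |f' x| := fun x hx => by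
    have : |f x₀| + |f' x₀| ≤ |f x| + |f' x| := hmin hx
    linarith
  obtain ⟨δ, hδ, hδf⟩ := Metric.uniformContinuousOn_iff_le.1
    (isCompact_Icc.uniformContinuousOn_of_continuous hf') μ hμ0
  have hfa' := abs_pos.2 hfa
  have hfb' := abs_pos.2 hfb
  obtain ⟨ε, hε⟩ : ∃ ε, ε = min (min μ (μ * δ / 2)) (min (|f a| / 3) (|f b| / 3)) := ⟨_, rfl⟩
  have hε0 : 0 < ε := by rw [hε]; positivity
  have e1 : ε ≤ μ := by simp [hε]
  have e2 : ε ≤ μ * δ / 2 := by simp [hε]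
  have e3 : ε ≤ |f a| / 3 := by simp [hε]
  have e4 : ε ≤ |f b| / 3 := by simp [hε]
  have hμδ : 0 < μ * δ := by positivity
  refine ⟨ε, hε0, fun g g' hg hfg hfg' => ?_⟩
  have hgc : ContinuousOn g (Icc a b) := fun x hx => (hg x hx).continuousAt.continuousWithinAt
  have hd : ∀ t ∈ Icc a b, (f t = 0 ∨ g t = 0) →
      (∀ y ∈ Icc a b, |y - t| ≤ δ → μ ≤ f' y ∧ μ ≤ g' y) ∨
      (∀ y ∈ Icc a b, |y - t| ≤ δ → f' y ≤ -μ ∧ g' y ≤ -μ) := by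
    intro t ht h0
    have hft : |f t| ≤ ε := by
      rcases h0 with h0 | h0
      · simp [h0, hε0.le]
      · simpa [h0] using hfg t ht
    have h1 := hμle t ht
    have h2 : 3 * μ ≤ |f' t| := by linarith
    rcases le_abs'.1 h2 with h3 | h3
    · right
      intro y hy hyt
      have h4 := abs_le.1 (hδf y hy t ht hyt)
      have h5 := abs_le.1 (hfg' y hy)
      constructor <;> linarith [h4.1, h4.2, h5.1, h5.2]
    · left
      intro y hy hyt
      have h4 := abs_le.1 (hδf y hy t ht hyt)
      have h5 := abs_le.1 (hfg' y hy)
      constructor <;> linarith [h4.1, h4.2, h5.1, h5.2]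
  have hga : |f a| - |g a| ≤ ε :=
    (abs_sub_abs_le_abs_sub _ _).trans (hfg a ⟨le_rfl, hab⟩)
  have hgb : |f b| - |g b| ≤ ε :=
    (abs_sub_abs_le_abs_sub _ _).trans (hfg b ⟨hab, le_rfl⟩)
  refine le_antisymm ?_ ?_
  · refine encard_zeros_le (ε := ε) hg hfc hδ hμ0 (by linarith) (by linarith)
      (by linarith) (fun x hx => by rw [abs_sub_comm]; exact hfg x hx) ?_
    intro t ht h0
    exact (hd t ht h0.symm).imp (fun h y hy hyt => (h y hy hyt).2)
      (fun h y hy hyt => (h y hy hyt).2)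
  · refine encard_zeros_le (ε := ε) hf hgc hδ hμ0 (by linarith) (by linarith)
      (by linarith) hfg ?_
    intro t ht h0
    exact (hd t ht h0).imp (fun h y hy hyt => (h y hy hyt).1)
      (fun h y hy hyt => (h y hy hyt).1)

/-- `f` is bounded on `S`, and Lipschitz in its second variable, uniformly in the first one. -/
def BddLipOn {Y : Type*} [NormedAddCommGroup Y] (S : Set (ℝ × Y)) (f : ℝ → Y → ℝ) : Prop :=
  ∃ C, 0 ≤ C ∧ (∀ ρ y, (ρ, y) ∈ S → |f ρ y| ≤ C) ∧
    ∀ ρ y y', (ρ, y) ∈ S → (ρ, y') ∈ S → |f ρ y - f ρ y'| ≤ C * ‖y - y'‖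

namespace BddLipOn

variable {Y : Type*} [NormedAddCommGroup Y] {S : Set (ℝ × Y)} {f g : ℝ → Y → ℝ}

lemma of_fst {φ : ℝ → ℝ} {C : ℝ} (h : ∀ ρ y, (ρ, y) ∈ S → |φ ρ| ≤ C) :
    BddLipOn S (fun ρ _ => φ ρ) := by
  refine ⟨max C 0, le_max_right _ _, fun ρ y hy => (h ρ y hy).trans (le_max_left _ _), ?_⟩
  intro ρ y y' _ _
  rw [sub_self, abs_zero]
  exact mul_nonneg (le_max_right _ _) (norm_nonneg _)

lemma const (a : ℝ) : BddLipOn S (fun _ _ => a) := of_fst (C := |a|) fun _ _ _ => le_rfl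

lemma add (hf : BddLipOn S f) (hg : BddLipOn S g) : BddLipOn S (fun ρ y => f ρ y + g ρ y) := by
  obtain ⟨C, hC, hf1, hf2⟩ := hf
  obtain ⟨D, hD, hg1, hg2⟩ := hg
  refine ⟨C + D, by positivity, ?_, ?_⟩
  · intro ρ y hy
    exact (abs_add_le _ _).trans (add_le_add (hf1 ρ y hy) (hg1 ρ y hy))
  · intro ρ y y' hy hy'
    rw [add_sub_add_comm, add_mul]
    exact (abs_add_le _ _).trans (add_le_add (hf2 ρ y y' hy hy') (hg2 ρ y y' hy hy'))

lemma mul (hf : BddLipOn S f) (hg : BddLipOn S g) : BddLipOn S (fun ρ y => f ρ y * g ρ y) := by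
  obtain ⟨C, hC, hf1, hf2⟩ := hf
  obtain ⟨D, hD, hg1, hg2⟩ := hg
  refine ⟨2 * C * D + C * D, by positivity, ?_, ?_⟩
  · intro ρ y hy
    rw [abs_mul]
    have := mul_le_mul (hf1 ρ y hy) (hg1 ρ y hy) (abs_nonneg _) hC
    nlinarith [mul_nonneg hC hD]
  · intro ρ y y' hy hy'
    have e : f ρ y * g ρ y - f ρ y' * g ρ y' =
        f ρ y * (g ρ y - g ρ y') + (f ρ y - f ρ y') * g ρ y' := by ring
    rw [e]
    have h1 := mul_le_mul (hf1 ρ y hy) (hg2 ρ y y' hy hy') (abs_nonneg _) hC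
    have h2 := mul_le_mul (hf2 ρ y y' hy hy') (hg1 ρ y' hy') (abs_nonneg _)
      (mul_nonneg hC (norm_nonneg _))
    refine (abs_add_le _ _).trans ?_
    rw [abs_mul, abs_mul]
    nlinarith [mul_nonneg (mul_nonneg hC hD) (norm_nonneg (y - y'))]

lemma pow (hf : BddLipOn S f) (n : ℕ) : BddLipOn S (fun ρ y => f ρ y ^ n) := by
  induction n with
  | zero => simpa using const (S := S) 1
  | succ n ih => simpa only [pow_succ] using ih.mul hf

lemma neg (hf : BddLipOn S f) : BddLipOn S (fun ρ y => -f ρ y) := by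
  simpa only [neg_one_mul] using (const (S := S) (-1)).mul hf

lemma inv (hf : BddLipOn S f) {m : ℝ} (hm : 0 < m) (h : ∀ ρ y, (ρ, y) ∈ S → m ≤ f ρ y) :
    BddLipOn S (fun ρ y => (f ρ y)⁻¹) := by
  obtain ⟨C, hC, hf1, hf2⟩ := hf
  refine ⟨m⁻¹ + C * (m ^ 2)⁻¹, by positivity, ?_, ?_⟩
  · intro ρ y hy
    have h1 := h ρ y hy
    rw [abs_of_pos (inv_pos.2 (hm.trans_le h1))]
    have h2 : (f ρ y)⁻¹ ≤ m⁻¹ := by gcongr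
    have : 0 ≤ C * (m ^ 2)⁻¹ := by positivity
    linarith
  · intro ρ y y' hy hy'
    have h1 := h ρ y hy
    have h2 := h ρ y' hy'
    have p1 := hm.trans_le h1
    have p2 := hm.trans_le h2
    rw [inv_sub_inv p1.ne' p2.ne', abs_div, abs_of_pos (mul_pos p1 p2), div_eq_mul_inv,
      abs_sub_comm]
    have h3 : (f ρ y * f ρ y')⁻¹ ≤ (m ^ 2)⁻¹ := by
      rw [sq]
      gcongr
    calc |f ρ y - f ρ y'| * (f ρ y * f ρ y')⁻¹ ≤ C * ‖y - y'‖ * (m ^ 2)⁻¹ :=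
          mul_le_mul (hf2 ρ y y' hy hy') h3 (by positivity) (by positivity)
      _ ≤ (m⁻¹ + C * (m ^ 2)⁻¹) * ‖y - y'‖ := by
          have : 0 ≤ m⁻¹ * ‖y - y'‖ := by positivity
          nlinarith

end BddLipOn

lemma abs_sin_sub_self_sub_le {a b L : ℝ} (ha : |a| ≤ L) (hb : |b| ≤ L) :
    |(sin a - a) - (sin b - b)| ≤ L ^ 2 * |a - b| := by
  have hd : ∀ x ∈ Icc (-L) L, HasDerivWithinAt (fun x => sin x - x) (cos x - 1) (Icc (-L) L) x :=
    fun x _ => ((hasDerivAt_sin x).sub (hasDerivAt_id' x)).hasDerivWithinAt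
  refine (convex_Icc (-L) L).norm_image_sub_le_of_norm_hasDerivWithin_le hd ?_
    (abs_le.1 hb) (abs_le.1 ha)
  intro x hx
  have h1 := one_sub_sq_div_two_le_cos (x := x)
  have h2 := cos_le_one x
  have h3 : x ^ 2 ≤ L ^ 2 := sq_le_sq' hx.1 hx.2
  rw [Real.norm_eq_abs, abs_le]
  constructor <;> nlinarith [sq_nonneg x]

lemma BddLipOn.sin_remainder {Y : Type*} [NormedAddCommGroup Y] {S : Set (ℝ × Y)}
    {f : ℝ → Y → ℝ} (hf : BddLipOn S f) {R : ℝ} (hS : ∀ ρ y, (ρ, y) ∈ S → ρ ∈ Ioc 0 R) :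
    BddLipOn S (fun ρ y => (sin (2 * ρ * f ρ y) - 2 * ρ * f ρ y) / ρ ^ 2) := by
  obtain ⟨C, hC, hf1, hf2⟩ := hf
  have key : ∀ ρ s t, ρ ∈ Ioc 0 R → |s| ≤ C → |t| ≤ C →
      |(sin (2 * ρ * s) - 2 * ρ * s) / ρ ^ 2 - (sin (2 * ρ * t) - 2 * ρ * t) / ρ ^ 2|
        ≤ 8 * R * C ^ 2 * |s - t| := by
    intro ρ s t hρ hs ht
    have hρ0 := hρ.1
    have hb : ∀ s, |s| ≤ C → |2 * ρ * s| ≤ 2 * ρ * C := fun s hs => by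
      rw [abs_mul, abs_of_pos (by positivity)]
      gcongr
    have h1 := abs_sin_sub_self_sub_le (hb s hs) (hb t ht)
    rw [← sub_div, abs_div, abs_of_pos (by positivity : 0 < ρ ^ 2), div_le_iff₀ (by positivity)]
    refine h1.trans ?_
    rw [← mul_sub, abs_mul, abs_of_pos (by positivity : 0 < 2 * ρ)]
    calc (2 * ρ * C) ^ 2 * (2 * ρ * |s - t|) = 8 * ρ * C ^ 2 * |s - t| * ρ ^ 2 := by ring
      _ ≤ 8 * R * C ^ 2 * |s - t| * ρ ^ 2 := by
        gcongr
        exact hρ.2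
  refine ⟨8 * |R| * C ^ 3, by positivity, ?_, ?_⟩
  · intro ρ y hy
    have h1 := key ρ (f ρ y) 0 (hS ρ y hy) (hf1 ρ y hy) (by simpa using hC)
    simp only [mul_zero, sin_zero, sub_zero, zero_div] at h1
    refine h1.trans ?_
    have := hf1 ρ y hy
    have := le_abs_self R
    rw [pow_succ C 2, ← mul_assoc]
    gcongr
  · intro ρ y y' hy hy'
    have h1 := key ρ (f ρ y) (f ρ y') (hS ρ y hy) (hf1 ρ y hy) (hf1 ρ y' hy')
    refine h1.trans ?_
    have := hf2 ρ y y' hy hy'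
    have := le_abs_self R
    rw [pow_succ C 2, ← mul_assoc, mul_assoc _ C]
    gcongr

/-- Deviation of the second derivative from its singular part, in terms of
`y = (2h + H', H' - h, (A - 1) / ρ, Z / ρ)` with `h = (H + π / 2) / ρ`. -/
def cssForce (α ρ : ℝ) (y : ℝ × ℝ × ℝ × ℝ) : ℝ :=
  (sin (2 * ρ * ((y.1 - y.2.1) / 3)) - 2 * ρ * ((y.1 - y.2.1) / 3)) / ρ ^ 2 *
      ((1 + ρ * y.2.2.1) * (1 - (ρ * y.2.2.2) ^ 2))⁻¹
    + 2 * ((y.1 - y.2.1) / 3) * ((1 + ρ * y.2.2.1) * (1 - (ρ * y.2.2.2) ^ 2))⁻¹ *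
      (-y.2.2.1 + ρ * y.2.2.2 ^ 2 + ρ ^ 2 * y.2.2.1 * y.2.2.2 ^ 2)
    + α * ρ * (1 + (ρ * y.2.2.2) ^ 2) * ((y.1 + 2 * y.2.1) / 3) ^ 3

/-- Regular part of the derivative of `(A - 1) / ρ`. -/
def cssForceA (α ρ : ℝ) (y : ℝ × ℝ × ℝ × ℝ) : ℝ :=
  -2 * α * (1 + ρ * y.2.2.1) * ((y.1 + 2 * y.2.1) / 3) ^ 2

/-- The derivative of `Z / ρ`. -/
def cssForceZ (α ρ : ℝ) (y : ℝ × ℝ × ℝ × ℝ) : ℝ :=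
  α * y.2.2.2 * (1 - (ρ * y.2.2.2) ^ 2) * ρ * ((y.1 + 2 * y.2.1) / 3) ^ 2

/-- Bounded states on which the force terms are regular. -/
def cssBox (R M m : ℝ) : Set (ℝ × ℝ × ℝ × ℝ × ℝ) :=
  {x | x.1 ∈ Ioc 0 R ∧ ‖x.2‖ ≤ M ∧ m ≤ 1 + x.1 * x.2.2.2.1 ∧ m ≤ 1 - (x.1 * x.2.2.2.2) ^ 2}

lemma bddLipOn_cssForce {α R M m : ℝ} (hm : 0 < m) :
    BddLipOn (cssBox R M m) (cssForce α) ∧ BddLipOn (cssBox R M m) (cssForceA α) ∧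
      BddLipOn (cssBox R M m) (cssForceZ α) := by
  set S := cssBox R M m with hS
  have hρ : BddLipOn S (fun ρ _ => ρ) :=
    BddLipOn.of_fst (C := R) fun ρ y hy => by
      rw [abs_of_pos hy.1.1]; exact hy.1.2
  have hcoord : ∀ φ : ℝ × ℝ × ℝ × ℝ → ℝ, (∀ y, |φ y| ≤ ‖y‖) → (∀ y z, φ (y - z) = φ y - φ z) →
      BddLipOn S (fun _ y => φ y) := by
    intro φ h1 h2
    refine ⟨max M 1, by positivity, fun ρ y hy => ((h1 y).trans hy.2.1).trans (le_max_left _ _),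
      fun ρ y y' _ _ => ?_⟩
    rw [← h2]
    exact (h1 _).trans (le_mul_of_one_le_left (norm_nonneg _) (le_max_right _ _))
  have hw : BddLipOn S (fun _ y => y.1) :=
    hcoord _ (fun y => norm_fst_le y) fun _ _ => rfl
  have hk : BddLipOn S (fun _ y => y.2.1) :=
    hcoord _ (fun y => (norm_fst_le y.2).trans (norm_snd_le y)) fun _ _ => rfl
  have hB : BddLipOn S (fun _ y => y.2.2.1) :=
    hcoord _ (fun y => (norm_fst_le y.2.2).trans ((norm_snd_le y.2).trans (norm_snd_le y)))
      fun _ _ => rfl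
  have hζ : BddLipOn S (fun _ y => y.2.2.2) :=
    hcoord _ (fun y => (norm_snd_le y.2.2).trans ((norm_snd_le y.2).trans (norm_snd_le y)))
      fun _ _ => rfl
  have hh : BddLipOn S (fun _ y => (y.1 - y.2.1) / 3) := by
    simpa only [sub_eq_add_neg, div_eq_mul_inv] using (hw.add hk.neg).mul (BddLipOn.const 3⁻¹)
  have hp : BddLipOn S (fun _ y => (y.1 + 2 * y.2.1) / 3) := by
    simpa only [div_eq_mul_inv] using
      (hw.add ((BddLipOn.const 2).mul hk)).mul (BddLipOn.const 3⁻¹)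
  have hA : BddLipOn S (fun ρ y => 1 + ρ * y.2.2.1) := (BddLipOn.const 1).add (hρ.mul hB)
  have hu : BddLipOn S (fun ρ y => 1 - (ρ * y.2.2.2) ^ 2) := by
    simpa only [sub_eq_add_neg] using (BddLipOn.const 1).add ((hρ.mul hζ).pow 2).neg
  have hr : BddLipOn S (fun ρ y => ((1 + ρ * y.2.2.1) * (1 - (ρ * y.2.2.2) ^ 2))⁻¹) :=
    (hA.mul hu).inv (mul_pos hm hm) fun ρ y hy =>
      mul_le_mul hy.2.2.1 hy.2.2.2 hm.le (hm.le.trans hy.2.2.1)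
  refine ⟨?_, ?_, ?_⟩
  · exact (((hh.sin_remainder fun ρ y hy => hy.1).mul hr).add
      ((((BddLipOn.const 2).mul hh).mul hr).mul
        ((hB.neg.add (hρ.mul (hζ.pow 2))).add (((hρ.pow 2).mul hB).mul (hζ.pow 2))))).add
      ((((BddLipOn.const α).mul hρ).mul
        ((BddLipOn.const 1).add ((hρ.mul hζ).pow 2))).mul (hp.pow 3))
  · exact ((BddLipOn.const (-2 * α)).mul hA).mul (hp.pow 2)
  · exact ((((BddLipOn.const α).mul hζ).mul hu).mul hρ).mul (hp.pow 2)

lemma tendsto_sub_div_of_tendsto_deriv {f f' : ℝ → ℝ} {f₀ e r : ℝ} (hr : 0 < r)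
    (hf : ∀ x ∈ Ioo 0 r, HasDerivAt f (f' x) x) (h0 : f 0 = f₀)
    (hlim : Tendsto f (𝓝[>] 0) (𝓝 f₀)) (hf' : Tendsto f' (𝓝[>] 0) (𝓝 e)) :
    Tendsto (fun x => (f x - f₀) / x) (𝓝[>] 0) (𝓝 e) := by
  have h1 : HasDerivWithinAt f e (Ici 0) 0 := by
    refine hasDerivWithinAt_Ici_of_tendsto_deriv (s := Ioo 0 r)
      (fun x hx => (hf x hx).differentiableAt.differentiableWithinAt) ?_ (Ioo_mem_nhdsGT hr) ?_
    · rw [ContinuousWithinAt, h0]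
      exact hlim.mono_left (nhdsWithin_mono _ Ioo_subset_Ioi_self)
    · refine hf'.congr' ?_
      filter_upwards [Ioo_mem_nhdsGT hr] with x hx
      exact (hf x hx).deriv.symm
  have h2 := (hasDerivWithinAt_iff_tendsto_slope' self_notMem_Ioi).1 h1.Ioi_of_Ici
  refine h2.congr fun x => ?_
  rw [slope_def_field, h0, sub_zero]

/-- The variables `(2h + H', H' - h, (A - 1) / ρ, Z / ρ)` with `h = (H + π / 2) / ρ`, in which
the system is regular at `ρ = 0` up to a dissipative diagonal term. -/
def cssState (H H' A Z : ℝ → ℝ) (ρ : ℝ) : ℝ × ℝ × ℝ × ℝ :=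
  (2 * ((H ρ + π / 2) / ρ) + H' ρ, H' ρ - (H ρ + π / 2) / ρ, (A ρ - 1) / ρ, Z ρ / ρ)

/-- Squared Euclidean distance of states. -/
def stateDist (y z : ℝ × ℝ × ℝ × ℝ) : ℝ :=
  (y.1 - z.1) ^ 2 + (y.2.1 - z.2.1) ^ 2 + (y.2.2.1 - z.2.2.1) ^ 2 + (y.2.2.2 - z.2.2.2) ^ 2

lemma abs_sub_le_sqrt_stateDist (y z : ℝ × ℝ × ℝ × ℝ) :
    |y.1 - z.1| ≤ √(stateDist y z) ∧ |y.2.1 - z.2.1| ≤ √(stateDist y z) ∧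
      |y.2.2.1 - z.2.2.1| ≤ √(stateDist y z) ∧ |y.2.2.2 - z.2.2.2| ≤ √(stateDist y z) := by
  have h1 := sq_nonneg (y.1 - z.1)
  have h2 := sq_nonneg (y.2.1 - z.2.1)
  have h3 := sq_nonneg (y.2.2.1 - z.2.2.1)
  have h4 := sq_nonneg (y.2.2.2 - z.2.2.2)
  refine ⟨?_, ?_, ?_, ?_⟩ <;> · apply abs_le_sqrt; unfold stateDist; linarith

lemma norm_sub_le_sqrt_stateDist (y z : ℝ × ℝ × ℝ × ℝ) : ‖y - z‖ ≤ √(stateDist y z) := by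
  obtain ⟨h1, h2, h3, h4⟩ := abs_sub_le_sqrt_stateDist y z
  exact max_le h1 (max_le h2 (max_le h3 h4))

namespace IsCOrbit

variable {α c : ℝ} {H H' A Z : ℝ → ℝ} {ρ₁ : ℝ}

lemma hasDerivAt_angle_div (h : IsCOrbit α c H H' A Z ρ₁) {ρ : ℝ} (hρ : ρ ∈ Ioo 0 ρ₁) :
    HasDerivAt (fun ρ => (H ρ + π / 2) / ρ) ((H' ρ - (H ρ + π / 2) / ρ) / ρ) ρ := by
  have hρ0 : ρ ≠ 0 := hρ.1.ne'
  refine (((h.hH ρ hρ).add_const (π / 2)).fun_div (hasDerivAt_id' ρ) hρ0).congr_deriv ?_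
  field_simp

lemma cssForce_cssState (h : IsCOrbit α c H H' A Z ρ₁) {ρ : ℝ} (hρ : ρ ∈ Ioo 0 ρ₁) :
    cssForce α ρ (cssState H H' A Z ρ) = 2 * ((H' ρ - (H ρ + π / 2) / ρ) / ρ) +
      (α * (1 + Z ρ ^ 2) * ρ * H' ρ ^ 3 - (2 / ρ) * H' ρ
        - sin (2 * H ρ) / (A ρ * ρ ^ 2 * (1 - Z ρ ^ 2))) := by
  have hρ0 : ρ ≠ 0 := hρ.1.ne'
  have hA := (h.hApos ρ hρ).ne'
  have hu := (h.one_sub_sq_pos hρ).ne'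
  obtain ⟨x, hx⟩ : ∃ x, x = (H ρ + π / 2) / ρ := ⟨_, rfl⟩
  have hs : sin (2 * H ρ) = -sin (2 * ρ * x) := by
    have : 2 * H ρ = 2 * ρ * x - π := by rw [hx]; field_simp; ring
    rw [this, sin_sub_pi]
  have e1 : (2 * x + H' ρ - (H' ρ - x)) / 3 = x := by ring
  have e2 : (2 * x + H' ρ + 2 * (H' ρ - x)) / 3 = H' ρ := by ring
  have e3 : 1 + ρ * ((A ρ - 1) / ρ) = A ρ := by field_simp; ring
  have e4 : ρ * (Z ρ / ρ) = Z ρ := by field_simp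
  simp only [cssForce, cssState, ← hx, e1, e2, e3, e4, hs]
  field_simp
  ring

lemma hasDerivAt_cssState (h : IsCOrbit α c H H' A Z ρ₁) {ρ : ℝ} (hρ : ρ ∈ Ioo 0 ρ₁) :
    HasDerivAt (fun ρ => (cssState H H' A Z ρ).1) (cssForce α ρ (cssState H H' A Z ρ)) ρ ∧
    HasDerivAt (fun ρ => (cssState H H' A Z ρ).2.1)
      (cssForce α ρ (cssState H H' A Z ρ) - 3 / ρ * (cssState H H' A Z ρ).2.1) ρ ∧
    HasDerivAt (fun ρ => (cssState H H' A Z ρ).2.2.1)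
      (cssForceA α ρ (cssState H H' A Z ρ) - 1 / ρ * (cssState H H' A Z ρ).2.2.1) ρ ∧
    HasDerivAt (fun ρ => (cssState H H' A Z ρ).2.2.2)
      (cssForceZ α ρ (cssState H H' A Z ρ)) ρ := by
  have hρ0 : ρ ≠ 0 := hρ.1.ne'
  have hx := h.hasDerivAt_angle_div hρ
  refine ⟨?_, ?_, ?_, ?_⟩
  · rw [h.cssForce_cssState hρ]
    exact (hx.const_mul 2).add (h.hH' ρ hρ)
  · refine ((h.hH' ρ hρ).sub hx).congr_deriv ?_
    rw [h.cssForce_cssState hρ]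
    simp only [cssState]
    ring
  · refine (((h.hA ρ hρ).sub_const 1).fun_div (hasDerivAt_id' ρ) hρ0).congr_deriv ?_
    simp only [cssState, cssForceA]
    field_simp
    ring
  · refine ((h.hZ ρ hρ).fun_div (hasDerivAt_id' ρ) hρ0).congr_deriv ?_
    simp only [cssState, cssForceZ]
    field_simp
    ring

lemma tendsto_cssState (h : IsCOrbit α c H H' A Z ρ₁) :
    Tendsto (cssState H H' A Z) (𝓝[>] 0) (𝓝 (3 * c, 0, 0, 1)) := by
  have h1 : Tendsto (fun ρ => (H ρ + π / 2) / ρ) (𝓝[>] 0) (𝓝 c) := by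
    simpa using tendsto_sub_div_of_tendsto_deriv h.rho1_pos h.hH h.H0 h.Hcont h.H'init
  have hid : Tendsto (fun ρ : ℝ => ρ) (𝓝[>] 0) (𝓝 0) := tendsto_nhdsWithin_of_tendsto_nhds
    tendsto_id
  have h2 : Tendsto (fun ρ => (A ρ - 1) / ρ) (𝓝[>] 0) (𝓝 0) := by
    refine tendsto_sub_div_of_tendsto_deriv h.rho1_pos h.hA h.A0 h.Acont ?_
    simpa using ((hid.const_mul (-2 * α)).mul h.Acont).mul (h.H'init.pow 2)
  have h3 : Tendsto (fun ρ => 2 * ((H ρ + π / 2) / ρ) + H' ρ) (𝓝[>] 0) (𝓝 (3 * c)) := by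
    have := (h1.const_mul 2).add h.H'init
    rwa [show 2 * c + c = 3 * c by ring] at this
  have h4 : Tendsto (fun ρ => H' ρ - (H ρ + π / 2) / ρ) (𝓝[>] 0) (𝓝 0) := by
    simpa using h.H'init.sub h1
  exact h3.prodMk_nhds (h4.prodMk_nhds (h2.prodMk_nhds h.Z'init))

lemma exists_norm_cssState_le (h : IsCOrbit α c H H' A Z ρ₁) {R : ℝ} (hR : R < ρ₁) :
    ∃ M, 0 ≤ M ∧ ∀ ρ ∈ Ioc 0 R, ‖cssState H H' A Z ρ‖ ≤ M := by
  have h1 := h.tendsto_cssState.norm.eventually_lt_const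
    (lt_add_one ‖((3 * c, 0, 0, 1) : ℝ × ℝ × ℝ × ℝ)‖)
  obtain ⟨s, hs, hsub⟩ := mem_nhdsGT_iff_exists_Ioc_subset.1 h1
  have hs0 : 0 < s := hs
  have hc : ContinuousOn (cssState H H' A Z) (Icc s R) := by
    intro x hx
    obtain ⟨d1, d2, d3, d4⟩ := h.hasDerivAt_cssState ⟨hs0.trans_le hx.1, hx.2.trans_lt hR⟩
    exact (d1.continuousAt.prodMk (d2.continuousAt.prodMk
      (d3.continuousAt.prodMk d4.continuousAt))).continuousWithinAt
  obtain ⟨C, hC⟩ := isCompact_Icc.exists_bound_of_continuousOn hc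
  refine ⟨max (‖((3 * c, 0, 0, 1) : ℝ × ℝ × ℝ × ℝ)‖ + 1) C, by positivity, fun ρ hρ => ?_⟩
  rcases le_total ρ s with hle | hle
  · exact le_max_of_le_left (hsub ⟨hρ.1, hle⟩).le
  · exact le_max_of_le_right (hC ρ ⟨hle, hρ.2⟩)

/-- Orbits depend continuously on `c`, in `C¹` up to the singular point `ρ = 0`. -/
theorem exists_forall_close (h : IsCOrbit α c H H' A Z ρ₁) (hα : 0 < α) (hα' : α < 1 / 2)
    {R : ℝ} (hR : R ∈ Ioo 0 ρ₁) {ε : ℝ} (hε : 0 < ε) :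
    ∃ δ > 0, ∀ (d r : ℝ) (G G' B Y : ℝ → ℝ), IsCOrbit α d G G' B Y r →
      Tendsto Y (𝓝[<] r) (𝓝 1) → |d - c| < δ →
      R < r ∧ ∀ ρ ∈ Ioc 0 R, |H ρ - G ρ| ≤ ε ∧ |H' ρ - G' ρ| ≤ ε ∧ |Z ρ - Y ρ| ≤ ε := by
  obtain ⟨M, hM0, hM⟩ := h.exists_norm_cssState_le hR.2
  have hR0 := hR.1
  obtain ⟨hz0, hz1⟩ := h.hZ01 R hR
  obtain ⟨η, hη⟩ : ∃ η, η = min (min 1 ε) (min ((1 - Z R) / 2 / R) (ε / R)) := ⟨_, rfl⟩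
  have hz1' : 0 < 1 - Z R := sub_pos.2 hz1
  have hη0 : 0 < η := by rw [hη]; positivity
  have hη1 : η ≤ 1 := by simp [hη]
  have hηε : η ≤ ε := by simp [hη]
  have hηz : R * η ≤ (1 - Z R) / 2 := by
    have : η ≤ (1 - Z R) / 2 / R := by simp [hη]
    rwa [le_div_iff₀ hR0, mul_comm] at this
  have hηR : R * η ≤ ε := by
    have : η ≤ ε / R := by simp [hη]
    rwa [le_div_iff₀ hR0, mul_comm] at this
  obtain ⟨z, hz⟩ : ∃ z, z = (1 + Z R) / 2 := ⟨_, rfl⟩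
  have hzlt : z < 1 := by linarith
  have hzpos : 0 ≤ z := by linarith
  obtain ⟨m, hm⟩ : ∃ m, m = min (1 - 2 * α) (1 - z ^ 2) := ⟨_, rfl⟩
  have hm0 : 0 < m := by
    rw [hm]
    exact lt_min (by linarith) (by nlinarith)
  have hm1 : m ≤ 1 - 2 * α := by simp [hm]
  have hm2 : m ≤ 1 - z ^ 2 := by simp [hm]
  obtain ⟨⟨C₁, hC₁, -, hL₁⟩, ⟨C₂, hC₂, -, hL₂⟩, ⟨C₃, hC₃, -, hL₃⟩⟩ :=
    bddLipOn_cssForce (α := α) (R := R) (M := M + 1) hm0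
  obtain ⟨K, hK⟩ : ∃ K, K = 4 * C₁ + 2 * C₂ + 2 * C₃ := ⟨_, rfl⟩
  have hK0 : 0 ≤ K := by rw [hK]; positivity
  obtain ⟨v, hv⟩ : ∃ v, v = η ^ 2 * exp (-((K + 1) * R)) := ⟨_, rfl⟩
  have hv0 : 0 < v := by rw [hv]; positivity
  have hvR : ∀ x ≤ R, v * exp ((K + 1) * x) ≤ η ^ 2 := by
    intro x hx
    rw [hv, mul_assoc, ← exp_add]
    have : exp (-((K + 1) * R) + (K + 1) * x) ≤ 1 := by
      rw [exp_le_one_iff]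
      nlinarith
    nlinarith [sq_nonneg η]
  refine ⟨√v / 3, by positivity, fun d r G G' B Y hG hY hd => ?_⟩
  set y := cssState H H' A Z with hy
  set w := cssState G G' B Y with hw
  have hZle : ∀ ρ ∈ Ioc 0 R, Z ρ ≤ Z R := fun ρ hρ =>
    h.Z_monotoneOn hα ⟨hρ.1, hρ.2.trans_lt hR.2⟩ hR hρ.2
  have hZY : ∀ ρ ∈ Ioc 0 R, stateDist (y ρ) (w ρ) ≤ η ^ 2 → |Z ρ - Y ρ| ≤ R * η := by
    intro ρ hρ hle
    have h1 := (abs_sub_le_sqrt_stateDist (y ρ) (w ρ)).2.2.2.trans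
      ((sqrt_le_sqrt hle).trans_eq (sqrt_sq hη0.le))
    have h2 : Z ρ - Y ρ = ρ * ((y ρ).2.2.2 - (w ρ).2.2.2) := by
      have := hρ.1.ne'
      simp only [hy, hw, cssState]
      field_simp
    rw [h2, abs_mul, abs_of_pos hρ.1]
    gcongr
    exact hρ.2
  have hbox : ∀ ρ ∈ Ioc 0 R, ρ < r → stateDist (y ρ) (w ρ) ≤ η ^ 2 →
      (ρ, y ρ) ∈ cssBox R (M + 1) m ∧ (ρ, w ρ) ∈ cssBox R (M + 1) m := by
    intro ρ hρ hρr hle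
    have hρ0 : ρ ≠ 0 := hρ.1.ne'
    have hρ₁ : ρ ∈ Ioo 0 ρ₁ := ⟨hρ.1, hρ.2.trans_lt hR.2⟩
    have hyM := hM ρ hρ
    have e1 : ∀ a : ℝ, 1 + ρ * ((a - 1) / ρ) = a := fun a => by field_simp; ring
    have e2 : ∀ a : ℝ, ρ * (a / ρ) = a := fun a => by field_simp
    refine ⟨⟨hρ, by linarith, ?_, ?_⟩, ⟨hρ, ?_, ?_, ?_⟩⟩
    · simp only [hy, cssState, e1]
      exact hm1.trans (h.le_A hα hρ₁)
    · simp only [hy, cssState, e2]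
      have := hZle ρ hρ
      have := (h.hZ01 ρ hρ₁).1
      nlinarith
    · have h1 := (norm_sub_le_sqrt_stateDist (y ρ) (w ρ)).trans
        ((sqrt_le_sqrt hle).trans_eq (sqrt_sq hη0.le))
      have h2 := norm_sub_norm_le (w ρ) (y ρ)
      rw [norm_sub_rev] at h2
      change ‖w ρ‖ ≤ M + 1
      linarith
    · simp only [hw, cssState, e1]
      exact hm1.trans (hG.le_A hα ⟨hρ.1, hρr⟩)
    · simp only [hw, cssState, e2]
      have h1 := abs_le.1 (hZY ρ hρ hle)
      have h2 := hZle ρ hρ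
      have h3 := (hG.hZ01 ρ ⟨hρ.1, hρr⟩).1
      have h4 : Y ρ ≤ z := by linarith [h1.1]
      nlinarith
  have hVder : ∀ ρ ∈ Ioc 0 R, ρ < r → HasDerivAt (fun ρ => stateDist (y ρ) (w ρ))
      (2 * ((y ρ).1 - (w ρ).1) * (cssForce α ρ (y ρ) - cssForce α ρ (w ρ))
      + 2 * ((y ρ).2.1 - (w ρ).2.1) * (cssForce α ρ (y ρ) - 3 / ρ * (y ρ).2.1
        - (cssForce α ρ (w ρ) - 3 / ρ * (w ρ).2.1))
      + 2 * ((y ρ).2.2.1 - (w ρ).2.2.1) * (cssForceA α ρ (y ρ) - 1 / ρ * (y ρ).2.2.1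
        - (cssForceA α ρ (w ρ) - 1 / ρ * (w ρ).2.2.1))
      + 2 * ((y ρ).2.2.2 - (w ρ).2.2.2) * (cssForceZ α ρ (y ρ) - cssForceZ α ρ (w ρ))) ρ := by
    intro ρ hρ hρr
    obtain ⟨a1, a2, a3, a4⟩ := h.hasDerivAt_cssState ⟨hρ.1, hρ.2.trans_lt hR.2⟩
    obtain ⟨b1, b2, b3, b4⟩ := hG.hasDerivAt_cssState ⟨hρ.1, hρr⟩
    refine (((((a1.fun_sub b1).fun_pow 2).fun_add ((a2.fun_sub b2).fun_pow 2)).fun_add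
      ((a3.fun_sub b3).fun_pow 2)).fun_add ((a4.fun_sub b4).fun_pow 2)).congr_deriv ?_
    simp [← hy, ← hw]
  have hV : ∀ ρ ∈ Ioc 0 R, ρ < r → stateDist (y ρ) (w ρ) ≤ η ^ 2 := by
    intro ρ hρ hρr
    have hlim : Tendsto (fun ρ => stateDist (y ρ) (w ρ)) (𝓝[>] 0) (𝓝 (9 * (d - c) ^ 2)) := by
      have hcont : Continuous (fun x : (ℝ × ℝ × ℝ × ℝ) × (ℝ × ℝ × ℝ × ℝ) =>
          stateDist x.1 x.2) := by
        unfold stateDist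
        fun_prop
      have := (hcont.tendsto _).comp (h.tendsto_cssState.prodMk_nhds hG.tendsto_cssState)
      have e : stateDist (3 * c, 0, 0, 1) (3 * d, 0, 0, 1) = 9 * (d - c) ^ 2 := by
        simp only [stateDist]
        ring
      rw [← e]
      exact this
    have hlt : 9 * (d - c) ^ 2 < v := by
      have h1 : |d - c| ^ 2 < (√v / 3) ^ 2 := by gcongr
      rw [sq_abs, div_pow, sq_sqrt hv0.le] at h1
      linarith
    obtain ⟨s, hsv, hs⟩ :=
      ((hlim.eventually_lt_const hlt).and (Ioo_mem_nhdsGT hρ.1)).exists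
    have hsub : ∀ x ∈ Icc s ρ, x ∈ Ioc 0 R ∧ x < r := fun x hx =>
      ⟨⟨hs.1.trans_le hx.1, hx.2.trans hρ.2⟩, hx.2.trans_lt hρr⟩
    refine (image_le_of_deriv_right_lt_deriv_boundary (B := fun x => v * exp ((K + 1) * x))
      (fun x hx => (hVder x (hsub x hx).1 (hsub x hx).2).continuousAt.continuousWithinAt)
      (fun x hx => (hVder x (hsub x (Ico_subset_Icc_self hx)).1
        (hsub x (Ico_subset_Icc_self hx)).2).hasDerivWithinAt) ?_
      (B' := fun x => (K + 1) * (v * exp ((K + 1) * x))) ?_ ?_ ⟨hs.2.le, le_rfl⟩).trans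
        (hvR ρ hρ.2)
    · refine hsv.le.trans (le_mul_of_one_le_right hv0.le ?_)
      rw [one_le_exp_iff]
      have := hs.1
      positivity
    · intro x
      refine ((((hasDerivAt_id' x).const_mul (K + 1)).exp).const_mul v).congr_deriv ?_
      ring
    · intro x hx heq
      obtain ⟨hxR, hxr⟩ := hsub x (Ico_subset_Icc_self hx)
      have hle := heq.trans_le (hvR x hxR.2)
      obtain ⟨hy', hw'⟩ := hbox x hxR hxr hle
      have hpos : 0 < stateDist (y x) (w x) := by rw [heq]; positivity
      rw [← heq]
      have hx0 := hxR.1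
      obtain ⟨d1, d2, d3, d4⟩ := abs_sub_le_sqrt_stateDist (y x) (w x)
      have hn := norm_sub_le_sqrt_stateDist (y x) (w x)
      have f1 := (hL₁ x _ _ hy' hw').trans (mul_le_mul_of_nonneg_left hn hC₁)
      have f2 := (hL₂ x _ _ hy' hw').trans (mul_le_mul_of_nonneg_left hn hC₂)
      have f3 := (hL₃ x _ _ hy' hw').trans (mul_le_mul_of_nonneg_left hn hC₃)
      have hsq := mul_self_sqrt hpos.le
      have hS0 := sqrt_nonneg (stateDist (y x) (w x))
      set S := √(stateDist (y x) (w x)) with hS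
      have prod : ∀ a b C : ℝ, |a| ≤ S → |b| ≤ C * S → a * b ≤ C * stateDist (y x) (w x) := by
        intro a b C ha hb
        refine (le_abs_self _).trans ?_
        rw [abs_mul, ← hsq]
        have := mul_le_mul ha hb (abs_nonneg _) hS0
        linarith
      have g1 := prod _ _ _ d1 f1
      have g2 := prod _ _ _ d2 f1
      have g3 := prod _ _ _ d3 f2
      have g4 := prod _ _ _ d4 f3
      have n2 : 0 ≤ 3 / x * ((y x).2.1 - (w x).2.1) ^ 2 := by positivity
      have n3 : 0 ≤ 1 / x * ((y x).2.2.1 - (w x).2.2.1) ^ 2 := by positivity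
      rw [hK]
      linarith
  have hRr : R < r := by
    by_contra! hle
    have : (1 : ℝ) ≤ z := by
      refine le_of_tendsto hY ?_
      filter_upwards [Ioo_mem_nhdsLT hG.rho1_pos] with ρ hρ
      have hρR : ρ ∈ Ioc 0 R := ⟨hρ.1, hρ.2.le.trans hle⟩
      have h1 := abs_le.1 (hZY ρ hρR (hV ρ hρR hρ.2))
      have h2 := hZle ρ hρR
      linarith [h1.1]
    linarith
  refine ⟨hRr, fun ρ hρ => ?_⟩
  have hle := hV ρ hρ (hρ.2.trans_lt hRr)
  have hs : √(stateDist (y ρ) (w ρ)) ≤ η := (sqrt_le_sqrt hle).trans_eq (sqrt_sq hη0.le)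
  obtain ⟨d1, d2, -, -⟩ := abs_sub_le_sqrt_stateDist (y ρ) (w ρ)
  have d1 := abs_le.1 (d1.trans hs)
  have d2 := abs_le.1 (d2.trans hs)
  refine ⟨?_, ?_, (hZY ρ hρ hle).trans hηR⟩
  · have e : H ρ - G ρ = ρ * ((((y ρ).1 - (w ρ).1) - ((y ρ).2.1 - (w ρ).2.1)) / 3) := by
      have := hρ.1.ne'
      simp only [hy, hw, cssState]
      field_simp
      ring
    rw [e, abs_mul, abs_of_pos hρ.1]
    refine le_trans ?_ hηR
    refine mul_le_mul hρ.2 ?_ (abs_nonneg _) hR0.le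
    rw [abs_le]
    constructor <;> linarith [d1.1, d1.2, d2.1, d2.2]
  · have e : H' ρ - G' ρ = (((y ρ).1 - (w ρ).1) + 2 * ((y ρ).2.1 - (w ρ).2.1)) / 3 := by
      simp only [hy, hw, cssState]
      ring
    rw [e, abs_le]
    constructor <;> linarith [d1.1, d1.2, d2.1, d2.2]

/-- The zeros of `H` can be confined to `[a, R]`, with `Z R` as close to `1` as needed for
`not_two_zeros`. -/
lemma exists_zeros_subset_Icc (h : IsCOrbit α c H H' A Z ρ₁) (hα : 0 < α) (hα' : α < 1 / 2)
    (hZ1 : Tendsto Z (𝓝[<] ρ₁) (𝓝 1)) :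
    ∃ a R, 0 < a ∧ a < R ∧ R < ρ₁ ∧ 1 - (1 - 2 * α) / 64 < Z R ∧ (∀ ρ ∈ Ioc 0 a, H ρ < -1) ∧
      ∀ ρ ∈ Ico R ρ₁, H ρ ≠ 0 := by
  have hz : 1 - (1 - 2 * α) / 64 < 1 := by linarith
  obtain ⟨s, hsZ, hs⟩ :=
    ((hZ1.eventually_const_lt hz).and (Ioo_mem_nhdsLT h.rho1_pos)).exists
  obtain ⟨R, hsR, hR, hH⟩ : ∃ R, s ≤ R ∧ R < ρ₁ ∧ ∀ ρ ∈ Ico R ρ₁, H ρ ≠ 0 := by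
    by_cases hex : ∃ t ∈ Ico s ρ₁, H t = 0
    · obtain ⟨t, ht, hHt⟩ := hex
      have ht0 : 0 < t := hs.1.trans_le ht.1
      obtain ⟨R, htR, hR⟩ := exists_between ht.2
      refine ⟨R, ht.1.trans htR.le, hR, fun ρ hρ hHρ => ?_⟩
      exact h.not_two_zeros hα hα' ht0 (htR.trans_le hρ.1) hρ.2
        (hsZ.le.trans (h.Z_monotoneOn hα hs ⟨ht0, ht.2⟩ ht.1)) hHt hHρ
    · push Not at hex
      exact ⟨s, le_rfl, hs.2, hex⟩
  have hR0 : 0 < R := hs.1.trans_le hsR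
  have hlt : -(π / 2) < -1 := by linarith [pi_gt_three]
  obtain ⟨a, ha, haH⟩ := mem_nhdsGT_iff_exists_Ioc_subset.1
    ((h.Hcont.eventually_lt_const hlt).and (Ioo_mem_nhdsGT hR0))
  exact ⟨a, R, ha, (haH ⟨ha, le_rfl⟩).2.2, hR,
    hsZ.trans_le (h.Z_monotoneOn hα hs ⟨hR0, hR⟩ hsR), fun ρ hρ => (haH hρ).1, hH⟩

end IsCOrbit

lemma ncard_eq_or_eq_add_one {S T U : Set ℝ} (hST : S.encard = T.encard) (hSU : S ⊆ U)
    (hU : (U \ S).Subsingleton) : U.ncard = T.ncard ∨ U.ncard = T.ncard + 1 := by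
  have hcard : S.ncard = T.ncard := by rw [ncard, ncard, hST]
  rw [← hcard]
  rcases hU.eq_empty_or_singleton with he | ⟨x, hx⟩
  · exact Or.inl (by rw [(sdiff_eq_empty.1 he).antisymm hSU])
  · have hxS : x ∉ S := (hx.ge rfl : x ∈ U \ S).2
    have hins : U = insert x S := by
      rw [← sdiff_union_of_subset hSU, hx, singleton_union]
    rw [hins]
    rcases S.finite_or_infinite with hS | hS
    · exact Or.inr (ncard_insert_of_notMem hxS hS)
    · exact Or.inl (by rw [hS.ncard, (hS.mono (subset_insert x S)).ncard])

/-- Lemma 8: if `H̄(c̃) = 0` then for `c` close to `c̃` the nodal number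
`N(c)` (the number of zeros of `H(·,c)` on `[0, ρ₁(c))`) equals `N(c̃)` or
`N(c̃) + 1`. -/
theorem lemma8 (α : ℝ) (hα0 : 0 < α) (hα : α < 1 / 2)
    (H H' A Z : ℝ → ℝ → ℝ) (ρ₁ : ℝ → ℝ)
    (horb : ∀ c, 0 < c → IsCOrbit α c (H c) (H' c) (A c) (Z c) (ρ₁ c))
    (hend : ∀ c, 0 < c → Tendsto (Z c) (𝓝[<] ρ₁ c) (𝓝 1))
    (ct : ℝ) (hct : 0 < ct)
    (hHbar : Tendsto (H ct) (𝓝[<] ρ₁ ct) (𝓝 0)) :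
    ∃ δ > 0, ∀ c, 0 < c → |c - ct| < δ →
      {ρ ∈ Set.Ioo 0 (ρ₁ c) | H c ρ = 0}.ncard
          = {ρ ∈ Set.Ioo 0 (ρ₁ ct) | H ct ρ = 0}.ncard ∨
      {ρ ∈ Set.Ioo 0 (ρ₁ c) | H c ρ = 0}.ncard
          = {ρ ∈ Set.Ioo 0 (ρ₁ ct) | H ct ρ = 0}.ncard + 1 := by
  have h := horb ct hct
  obtain ⟨a, R, ha, haR, hR, hZR, hHa, hHR⟩ :=
    h.exists_zeros_subset_Icc hα0 hα (hend ct hct)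
  have hR0 : 0 < R := ha.trans haR
  have hsub : ∀ x ∈ Icc a R, x ∈ Ioo 0 (ρ₁ ct) := fun x hx =>
    ⟨ha.trans_le hx.1, hx.2.trans_lt hR⟩
  obtain ⟨ε, hε, hcount⟩ := exists_encard_zeros_eq haR.le (fun x hx => h.hH x (hsub x hx))
    (fun x hx => (h.hH' x (hsub x hx)).continuousAt.continuousWithinAt)
    (by linarith [hHa a ⟨ha, le_rfl⟩]) (hHR R ⟨le_rfl, hR⟩)
    (fun x hx => h.deriv_ne_zero hα0 hα (hsub x hx))
  obtain ⟨e, he⟩ : ∃ e, e = min ε (min (1 / 2) (Z ct R - (1 - (1 - 2 * α) / 64))) := ⟨_, rfl⟩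
  have hZR' := sub_pos.2 hZR
  have he0 : 0 < e := by rw [he]; positivity
  have he1 : e ≤ ε := by simp [he]
  have he2 : e ≤ 1 / 2 := by simp [he]
  have he3 : e ≤ Z ct R - (1 - (1 - 2 * α) / 64) := by rw [he]; simp
  obtain ⟨δ, hδ, hclose⟩ := h.exists_forall_close hα0 hα ⟨hR0, hR⟩ he0
  refine ⟨δ, hδ, fun c hc hcδ => ?_⟩
  have hG := horb c hc
  obtain ⟨hRc, hcl⟩ := hclose c _ _ _ _ _ hG (hend c hc) hcδ
  have hpos : ∀ x ∈ Icc a R, x ∈ Ioc 0 R := fun x hx => ⟨ha.trans_le hx.1, hx.2⟩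
  have henc := hcount (H c) (H' c)
    (fun x hx => hG.hH x ⟨ha.trans_le hx.1, hx.2.trans_lt hRc⟩)
    (fun x hx => (hcl x (hpos x hx)).1.trans he1)
    (fun x hx => (hcl x (hpos x hx)).2.1.trans he1)
  have hzeros : {x ∈ Icc a R | H ct x = 0} = {ρ ∈ Ioo 0 (ρ₁ ct) | H ct ρ = 0} := by
    ext x
    refine ⟨fun hx => ⟨hsub x hx.1, hx.2⟩, fun hx => ⟨⟨?_, ?_⟩, hx.2⟩⟩
    · by_contra! hlt
      linarith [hHa x ⟨hx.1.1, hlt.le⟩, hx.2]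
    · by_contra! hlt
      exact hHR x ⟨hlt.le, hx.1.2⟩ hx.2
  rw [hzeros] at henc
  refine ncard_eq_or_eq_add_one henc
    (fun x hx => ⟨⟨ha.trans_le hx.1.1, hx.1.2.trans_lt hRc⟩, hx.2⟩) ?_
  have hZc : 1 - (1 - 2 * α) / 64 ≤ Z c R := by
    linarith [(abs_le.1 (hcl R ⟨hR0, le_rfl⟩).2.2).2]
  have hgt : ∀ x ∈ {ρ ∈ Ioo 0 (ρ₁ c) | H c ρ = 0} \ {x ∈ Icc a R | H c x = 0},
      R < x := by
    rintro x ⟨⟨hx, hHx⟩, hx'⟩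
    by_contra! hle
    refine hx' ⟨⟨?_, hle⟩, hHx⟩
    by_contra! hlt
    linarith [(abs_le.1 (hcl x ⟨hx.1, hle⟩).1).1, hHa x ⟨hx.1, hlt.le⟩]
  have hno : ∀ x ∈ Ioo R (ρ₁ c), ∀ y ∈ Ioo R (ρ₁ c), H c x = 0 → H c y = 0 → ¬ x < y :=
    fun x hx y hy hHx hHy hxy => hG.not_two_zeros hα0 hα (hR0.trans hx.1) hxy hy.2
      (hZc.trans (hG.Z_monotoneOn hα0 ⟨hR0, hRc⟩ ⟨hR0.trans hx.1, hx.2⟩ hx.1.le)) hHx hHy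
  intro x hx y hy
  have hx' : x ∈ Ioo R (ρ₁ c) := ⟨hgt x hx, hx.1.1.2⟩
  have hy' : y ∈ Ioo R (ρ₁ c) := ⟨hgt y hy, hy.1.1.2⟩
  exact le_antisymm (not_lt.1 (hno y hy' x hx' hy.1.2 hx.1.2))
    (not_lt.1 (hno x hx' y hy' hx.1.2 hy.1.2))
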